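/- arXiv:math/0509308 — 4 statements merged into one kernel-verified Lean document; each statement's English description precedes it below -/
import Mathlib

section
/- (Theorem 1, finite-order case.) Let H ≥ 1 be a natural number, let Λ = {λ_1,…,λ_m} be a finite set of real numbers, and let f : ℝ → [0,∞) be H times continuously differentiable on ℝ \ Λ. Assume there exist q ∈ (0,1) and a ∈ (0,1) such that for every j ∈ {1,…,m} and every l ≤ H, exp(−a/|λ−λ_j|^q)·|f^{(l)}(λ)| → 0 as λ → λ_j (λ ∉ Λ). Then there exists a measurable function g : ℝ × (0,∞) → [0,∞) such that: (i) for every y > 0 the function λ ↦ g(λ,y) is H times continuously differentiable on ℝ and its derivatives of all orders l ≤ H (including order 0) vanish at each λ_j ∈ Λ; and (ii) f(λ) = ∫_0^∞ g(λ,y) dy for every λ ∉ Λ. -/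
open MeasureTheory Filter Topology

/-- A smooth nonnegative function on `ℝ`, vanishing on `(-∞, 1]`, with integral one over `(0, ∞)`. -/
lemma exists_smooth_mollifier_vanishing_Iic_one :
    ∃ ψ : ℝ → ℝ, (∀ n : ℕ∞, ContDiff ℝ n ψ) ∧ (∀ x, 0 ≤ ψ x) ∧ (∀ x ≤ 1, ψ x = 0) ∧
      ∫ x in Set.Ioi (0 : ℝ), ψ x = 1 := by
  let b : ContDiffBump (2 : ℝ) := ⟨1 / 2, 1, by norm_num, by norm_num⟩
  have hb : ∀ x ≤ 1, b.normed volume x = 0 := fun x hx => by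
    rw [← Function.notMem_support, b.support_normed_eq, Metric.mem_ball, Real.dist_eq, not_lt]
    exact le_trans (by change (1 : ℝ) ≤ -(x - 2); linarith) (neg_le_abs _)
  refine ⟨b.normed volume, fun n => b.contDiff_normed, fun x => b.nonneg_normed x, hb, ?_⟩
  rw [setIntegral_eq_integral_of_forall_compl_eq_zero, b.integral_normed]
  intro x hx
  exact hb x (by rw [Set.mem_Ioi, not_lt] at hx; linarith)

/-- A smooth nonnegative function whose zero set is exactly the given finite set. -/
lemma exists_smooth_zero_set_eq_finset (Λ : Finset ℝ) :
    ∃ D : ℝ → ℝ, (∀ n : ℕ∞, ContDiff ℝ n D) ∧ (∀ x ∈ Λ, D x = 0) ∧ (∀ x ∉ Λ, 0 < D x) ∧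
      ∀ x, 0 ≤ D x := by
  refine ⟨fun x => ∏ c ∈ Λ, (x - c) ^ 2, fun n => ?_, fun x hx => ?_, fun x hx => ?_, fun x => ?_⟩
  · exact contDiff_prod fun c _ => (contDiff_id.sub contDiff_const).pow 2
  · exact Finset.prod_eq_zero hx (by simp)
  · refine Finset.prod_pos fun c hc => sq_pos_of_ne_zero (sub_ne_zero.2 ?_)
    rintro rfl
    exact hx hc
  · exact Finset.prod_nonneg fun c _ => sq_nonneg _

/-- Theorem 1, finite-order case: if `f : ℝ → [0,∞)` is `C^H` off a finite
set `Λ` (with `H ≥ 1`) and its derivatives of all orders `l ≤ H` are controlled near each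
`λ_j ∈ Λ` by `exp(a/|λ-λ_j|^q)` with `0 < q < 1`, `0 < a < 1`, then `f` is a Lebesgue
mixture over `y ∈ (0,∞)` of densities `g(·,y)` that are `C^H` on all of ℝ with all
derivatives of orders `l ≤ H` (including order 0) vanishing at every point of `Λ`. -/
theorem disaggregation_CH_finite_singularities
    (H : ℕ) (hH : 1 ≤ H)
    (Λ : Finset ℝ) (f : ℝ → ℝ) (hf0 : ∀ x, 0 ≤ f x)
    (hsmooth : ContDiffOn ℝ (H : ℕ∞) f ((↑Λ : Set ℝ)ᶜ))
    (q a : ℝ) (hq0 : 0 < q) (hq1 : q < 1) (ha0 : 0 < a) (ha1 : a < 1)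
    (hctrl : ∀ lj ∈ Λ, ∀ l : ℕ, l ≤ H →
      Tendsto (fun x : ℝ => Real.exp (-(a / |x - lj| ^ q)) * |iteratedDeriv l f x|)
        (nhdsWithin lj ((↑Λ : Set ℝ)ᶜ)) (nhds 0)) :
    ∃ g : ℝ → ℝ → ℝ,
      Measurable (fun p : ℝ × ℝ => g p.1 p.2) ∧
      (∀ x y, 0 ≤ g x y) ∧
      (∀ y : ℝ, 0 < y →
        ContDiff ℝ (H : ℕ∞) (fun x => g x y) ∧
        ∀ lj ∈ Λ, ∀ l : ℕ, l ≤ H → iteratedDeriv l (fun x => g x y) lj = 0) ∧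
      (∀ x : ℝ, x ∉ Λ → f x = ∫ y in Set.Ioi (0 : ℝ), g x y) := by
  obtain ⟨ψ, hψ, hψ0, hψ1, hψint⟩ := exists_smooth_mollifier_vanishing_Iic_one
  obtain ⟨D, hD, hDz, hDpos, hD0⟩ := exists_smooth_zero_set_eq_finset Λ
  have hopen : IsOpen ((↑Λ : Set ℝ)ᶜ) := Λ.finite_toSet.isClosed.isOpen_compl
  have hfm : Measurable f := measurable_of_measurable_on_compl_finite (↑Λ : Set ℝ) Λ.finite_toSet
    (continuousOn_iff_continuous_domRestrict.1 hsmooth.continuousOn).measurable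
  have hDc : Continuous D := (hD 0).continuous
  have hψc : Continuous ψ := (hψ 0).continuous
  have hlocal : ∀ y : ℝ, ∀ c ∈ Λ, (fun x => f x * (ψ (y * D x) * D x)) =ᶠ[𝓝 c] fun _ => 0 := by
    intro y c hc
    have h1 : ∀ᶠ x in 𝓝 c, y * D x < 1 :=
      (continuous_const.mul hDc).continuousAt.eventually_lt continuousAt_const (by simp [hDz c hc])
    filter_upwards [h1] with x hx
    simp [hψ1 _ hx.le]
  refine ⟨fun x y => f x * (ψ (y * D x) * D x), ?_, fun x y => ?_, fun y _ => ⟨?_, ?_⟩, ?_⟩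
  · have hc : Continuous fun p : ℝ × ℝ => ψ (p.2 * D p.1) * D p.1 := by fun_prop
    exact (hfm.comp measurable_fst).mul hc.measurable
  · exact mul_nonneg (hf0 x) (mul_nonneg (hψ0 _) (hD0 x))
  · refine contDiff_iff_contDiffAt.2 fun x => ?_
    by_cases hx : x ∈ Λ
    · exact contDiffAt_const.congr_of_eventuallyEq (hlocal y x hx)
    · exact (hsmooth.contDiffAt (hopen.mem_nhds hx)).mul
        (((hψ H).comp (contDiff_const.mul (hD H))).mul (hD H)).contDiffAt
  · intro c hc l _
    rw [(hlocal y c hc).iteratedDeriv_eq l]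
    simp
  · intro x hx
    have hpos := hDpos x hx
    rw [integral_const_mul, integral_mul_const, integral_comp_mul_right_Ioi ψ 0 hpos, zero_mul,
      hψint, smul_eq_mul, mul_one, inv_mul_cancel₀ hpos.ne', mul_one]
end

section
/- (Theorem 2, one accumulation point, H = ∞.) Let (a,b) ⊂ ℝ be an open interval, let (λ_j)_{j≥1} be a strictly increasing sequence in (a,b) converging to λ_∞ < b, and set Λ = {λ_j : j ≥ 1} ∪ {λ_∞}. Let f : (a,b) → [0,∞) be integrable on (a,b) and infinitely differentiable on (a,b) \ Λ, and assume there exist q ∈ (0,1) and a constant a₀ ∈ (0,1) such that for every λ* ∈ Λ and every l ∈ ℕ, exp(−a₀/|λ−λ*|^q)·|f^{(l)}(λ)| → 0 as λ → λ* (λ ∉ Λ). Then there exists a measurable function g : (a,b) × (0,∞) → [0,∞) such that: (i) for every y > 0 the function λ ↦ g(λ,y) is infinitely differentiable on (a,b) and all its derivatives (including the function itself) vanish at every point of Λ; and (ii) f(λ) = ∫_0^∞ g(λ,y) dy for every λ ∈ (a,b) \ Λ. -/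
open MeasureTheory Filter Topology

/-- A smooth nonnegative function on `ℝ` supported away from `y ≤ 1`, with unit mass on
`(0,∞)`. -/
theorem exists_contDiff_unit_mass_Ioi :
    ∃ ρ : ℝ → ℝ, ContDiff ℝ (⊤ : ℕ∞) ρ ∧ (∀ y, 0 ≤ ρ y) ∧ (∀ y ≤ 1, ρ y = 0) ∧
      ∫ y in Set.Ioi (0 : ℝ), ρ y = 1 := by
  let β : ContDiffBump (3 : ℝ) := ⟨1, 2, one_pos, one_lt_two⟩
  have hzero : ∀ y ≤ 1, β.normed volume y = 0 := by
    intro y hy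
    rw [← Function.notMem_support, β.support_normed_eq, Metric.mem_ball, Real.dist_eq, not_lt]
    change (2 : ℝ) ≤ |y - 3|
    rw [abs_of_nonpos] <;> linarith
  refine ⟨β.normed volume, β.contDiff_normed, β.nonneg_normed, hzero, ?_⟩
  rw [setIntegral_eq_integral_of_forall_compl_eq_zero, β.integral_normed]
  intro y hy
  exact hzero y ((not_lt.mp hy).trans zero_le_one)

/-- A nonnegative function smooth on an open set `U` is a mixture over `y ∈ (0,∞)` of smooth
functions on `ℝ`, each vanishing in a neighbourhood of the complement of `U`. -/
theorem exists_contDiff_mixture_of_isOpen {U : Set ℝ} (hU : IsOpen U) {f : ℝ → ℝ}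
    (hf0 : ∀ x ∈ U, 0 ≤ f x) (hf : ContDiffOn ℝ (⊤ : ℕ∞) f U) :
    ∃ g : ℝ → ℝ → ℝ,
      Measurable (fun p : ℝ × ℝ => g p.1 p.2) ∧
      (∀ x y, 0 ≤ g x y) ∧
      (∀ y, ContDiff ℝ (⊤ : ℕ∞) (fun x => g x y)) ∧
      (∀ y, ∀ x ∉ U, (fun x => g x y) =ᶠ[𝓝 x] 0) ∧
      (∀ x ∈ U, f x = ∫ y in Set.Ioi (0 : ℝ), g x y) := by
  obtain ⟨ρ, hρ, hρ0, hρ1, hρint⟩ := exists_contDiff_unit_mass_Ioi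
  obtain ⟨φ, hφU, hφ, hφrange⟩ := hU.exists_contDiff_support_eq (n := ⊤)
  have hφ0 : ∀ x, 0 ≤ φ x := fun x => (hφrange (Set.mem_range_self x)).1
  have hvanish : ∀ y, ∀ x ∉ U,
      (fun x => U.indicator f x * (φ x * ρ (φ x * y))) =ᶠ[𝓝 x] 0 := by
    intro y x hx
    have hx0 : φ x = 0 := by
      rw [← hφU] at hx
      exact Function.notMem_support.mp hx
    have hlt : ∀ᶠ z in 𝓝 x, φ z * y < 1 :=
      (hφ.continuous.mul continuous_const).continuousAt.eventually_lt continuousAt_const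
        (by simp [hx0])
    filter_upwards [hlt] with z hz
    simp [hρ1 _ hz.le]
  refine ⟨fun x y => U.indicator f x * (φ x * ρ (φ x * y)), ?_, ?_, ?_, hvanish, ?_⟩
  · have hmeas : Measurable (U.indicator f) := by
      classical
      rw [← Set.piecewise_eq_indicator]
      exact hf.continuousOn.measurable_piecewise continuousOn_const hU.measurableSet
    have hφm := hφ.continuous.measurable
    have hρm := hρ.continuous.measurable
    fun_prop
  · intro x y
    exact mul_nonneg (Set.indicator_nonneg hf0 x) (mul_nonneg (hφ0 x) (hρ0 _))
  · intro y
    rw [contDiff_iff_contDiffAt]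
    intro x
    by_cases hx : x ∈ U
    · have hUx := hU.mem_nhds hx
      have hfx : ContDiffAt ℝ (⊤ : ℕ∞) (U.indicator f) x :=
        (hf.contDiffAt hUx).congr_of_eventuallyEq
          (Set.eqOn_indicator.eventuallyEq_of_mem hUx)
      exact hfx.mul (hφ.mul (hρ.comp (hφ.mul contDiff_const))).contDiffAt
    · exact contDiffAt_const.congr_of_eventuallyEq (hvanish y x hx)
  · intro x hx
    have hne : φ x ≠ 0 := by
      rw [← hφU] at hx
      exact hx
    have hpos : 0 < φ x := lt_of_le_of_ne (hφ0 x) hne.symm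
    rw [integral_const_mul, integral_const_mul, integral_comp_mul_left_Ioi ρ 0 hpos, mul_zero,
      hρint, smul_eq_mul, mul_one, mul_inv_cancel₀ hne, mul_one, Set.indicator_of_mem hx]

/-- Theorem 2, one accumulation point, `H = ∞`: let `(λ_j)` be a strictly
increasing sequence in `(a,b)` converging to `λ∞ < b` and `Λ = {λ_j} ∪ {λ∞}`. If
`f : (a,b) → [0,∞)` is integrable on `(a,b)`, `C^∞` on `(a,b) \ Λ`, and all its
derivatives are controlled near each point of `Λ` by `exp(a₀/|λ-λ*|^q)` with
`0 < q < 1`, `0 < a₀ < 1`, then `f` is a Lebesgue mixture over `y ∈ (0,∞)` of densities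
`g(·,y)` that are `C^∞` on `(a,b)` and flat at every point of `Λ`. -/
theorem disaggregation_Cinfty_countable_singularities
    (a b : ℝ) (hab : a < b)
    (lam : ℕ → ℝ) (lamInf : ℝ)
    (hmono : StrictMono lam) (hmem : ∀ j, lam j ∈ Set.Ioo a b)
    (hlim : Tendsto lam atTop (nhds lamInf)) (hinfb : lamInf < b)
    (Λ : Set ℝ) (hΛ : Λ = Set.range lam ∪ {lamInf})
    (f : ℝ → ℝ) (hf0 : ∀ x ∈ Set.Ioo a b, 0 ≤ f x)
    (hint : IntegrableOn f (Set.Ioo a b))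
    (hsmooth : ContDiffOn ℝ (⊤ : ℕ∞) f (Set.Ioo a b \ Λ))
    (q a₀ : ℝ) (hq0 : 0 < q) (hq1 : q < 1) (ha₀0 : 0 < a₀) (ha₀1 : a₀ < 1)
    (hctrl : ∀ ls ∈ Λ, ∀ l : ℕ,
      Tendsto (fun x : ℝ =>
          Real.exp (-(a₀ / |x - ls| ^ q)) * |iteratedDerivWithin l f (Set.Ioo a b \ Λ) x|)
        (nhdsWithin ls (Set.Ioo a b \ Λ)) (nhds 0)) :
    ∃ g : ℝ → ℝ → ℝ,
      Measurable (fun p : ℝ × ℝ => g p.1 p.2) ∧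
      (∀ x y, 0 ≤ g x y) ∧
      (∀ y : ℝ, 0 < y →
        ContDiffOn ℝ (⊤ : ℕ∞) (fun x => g x y) (Set.Ioo a b) ∧
        ∀ ls ∈ Λ, ∀ n : ℕ, iteratedDerivWithin n (fun x => g x y) (Set.Ioo a b) ls = 0) ∧
      (∀ x ∈ Set.Ioo a b \ Λ, f x = ∫ y in Set.Ioi (0 : ℝ), g x y) := by
  have hclosed : IsClosed Λ := by
    rw [hΛ, Set.union_singleton]
    exact hlim.isCompact_insert_range.isClosed
  obtain ⟨g, hgm, hg0, hgs, hgΛ, hgf⟩ := exists_contDiff_mixture_of_isOpen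
    (isOpen_Ioo.sdiff hclosed) (fun x hx => hf0 x hx.1) hsmooth
  refine ⟨g, hgm, hg0, fun y _ => ⟨(hgs y).contDiffOn, fun ls hls n => ?_⟩, hgf⟩
  have hzero := hgΛ y ls fun h => h.2 hls
  rw [hzero.filter_mono nhdsWithin_le_nhds |>.iteratedDerivWithin_eq hzero.self_of_nhds]
  simp
end

section
/- (Impossibility of analytic disaggregation.) Let f : ℝ → ℝ be infinitely differentiable with f ≥ 0, suppose there exists λ₀ ∈ ℝ with f^{(j)}(λ₀) = 0 for every j ∈ ℕ (including j = 0), and suppose f is not identically zero (there exists λ₁ with f(λ₁) > 0). Then there do NOT exist a measurable space Y, a probability measure μ on Y, and a function g : ℝ × Y → ℝ, measurable in y for each λ, with g(λ,y) ≥ 0 for all λ and μ-a.e. y, such that λ ↦ g(λ,y) is analytic on all of ℝ for μ-a.e. y and f(λ) = ∫_Y g(λ,y) dμ(y) for every λ ∈ ℝ. -/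
open MeasureTheory Filter Topology

/-- A smooth function whose derivatives all vanish at `c` is `o((x - c) ^ n)` for every `n`. -/
theorem isLittleO_pow_of_iteratedDeriv_eq_zero {f : ℝ → ℝ} (hf : ContDiff ℝ (⊤ : ℕ∞) f) {c : ℝ}
    (hc : ∀ j : ℕ, iteratedDeriv j f c = 0) (n : ℕ) :
    f =o[𝓝 c] fun x => (x - c) ^ n := by
  have h := taylor_isLittleO_univ (x₀ := c) (n := n) (hf.of_le (by exact_mod_cast le_top))
  simpa [taylor_within_apply, iteratedDerivWithin_univ, hc] using h

/-- If a smooth function is flat at some point and not identically zero, it is flat at a point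
which is a limit of points where it does not vanish. -/
theorem exists_flat_point_frequently_ne_zero {f : ℝ → ℝ} (hf : ContDiff ℝ (⊤ : ℕ∞) f) {a b : ℝ}
    (ha : ∀ j : ℕ, iteratedDeriv j f a = 0) (hb : f b ≠ 0) :
    ∃ c, (∀ j : ℕ, iteratedDeriv j f c = 0) ∧ ∃ᶠ x in 𝓝 c, f x ≠ 0 := by
  have hclosed : IsClosed {x | ∀ j : ℕ, iteratedDeriv j f x = 0} := by
    simp only [Set.ofPred_forall]
    exact isClosed_iInter fun j => isClosed_eq
      (hf.continuous_iteratedDeriv j (by exact_mod_cast le_top)) continuous_const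
  obtain ⟨c, hc⟩ : (frontier {x | ∀ j : ℕ, iteratedDeriv j f x = 0}).Nonempty := by
    refine nonempty_frontier_iff.2 ⟨⟨a, ha⟩, fun h => hb ?_⟩
    have hbmem : b ∈ {x | ∀ j : ℕ, iteratedDeriv j f x = 0} := h ▸ Set.mem_univ b
    simpa using hbmem 0
  rw [hclosed.frontier_eq] at hc
  refine ⟨c, hc.1, fun hzero => hc.2 ?_⟩
  rw [mem_interior_iff_mem_nhds]
  filter_upwards [eventually_eventually_nhds.2 hzero] with x hx j
  have hx' : f =ᶠ[𝓝 x] fun _ => 0 := hx.mono fun z hz => not_not.1 hz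
  rw [hx'.iteratedDeriv_eq j]
  simp

/-- A function analytic at `c` and not vanishing identically near `c` has a positive limit
after division by a suitable power of the distance to `c`. -/
theorem AnalyticAt.exists_tendsto_abs_div_pow {φ : ℝ → ℝ} {c : ℝ} (hφ : AnalyticAt ℝ φ c)
    (hne : ¬ ∀ᶠ x in 𝓝 c, φ x = 0) :
    ∃ (k : ℕ) (l : ℝ), 0 < l ∧ Tendsto (fun x => |φ x| / |x - c| ^ k) (𝓝[≠] c) (𝓝 l) := by
  obtain ⟨k, h, h_an, h_ne, h_eq⟩ := hφ.exists_eventuallyEq_pow_smul_nonzero_iff.2 hne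
  refine ⟨k, |h c|, abs_pos.2 h_ne,
    (h_an.continuousAt.abs.tendsto.mono_left nhdsWithin_le_nhds).congr' ?_⟩
  filter_upwards [h_eq.filter_mono nhdsWithin_le_nhds, self_mem_nhdsWithin] with x hx hxc
  have : |x - c| ^ k ≠ 0 := pow_ne_zero _ (abs_ne_zero.2 (sub_ne_zero.2 hxc))
  rw [hx, smul_eq_mul, abs_mul, abs_pow, mul_div_cancel_left₀ _ this]

/-- Fatou's lemma for rescaled integrals: if the integrals `∫ g n` of nonnegative functions are
positive and `(∫ g n) / w n` tends to zero, then the lower limit of `g n y / w n` vanishes for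
almost every `y`. -/
theorem ae_liminf_ofReal_div_eq_zero {Y : Type*} [MeasurableSpace Y] {μ : Measure Y}
    {w : ℕ → ℝ} {g : ℕ → Y → ℝ} (hg : ∀ n, Measurable (g n)) (hg0 : ∀ᵐ y ∂μ, ∀ n, 0 ≤ g n y)
    (hw : ∀ n, 0 ≤ w n) (hpos : ∀ n, 0 < ∫ y, g n y ∂μ)
    (hlim : Tendsto (fun n => (∫ y, g n y ∂μ) / w n) atTop (𝓝 0)) :
    ∀ᵐ y ∂μ, liminf (fun n => ENNReal.ofReal (g n y / w n)) atTop = 0 := by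
  have hmeas (n : ℕ) : Measurable fun y => ENNReal.ofReal (g n y / w n) :=
    ((hg n).div_const _).ennreal_ofReal
  have hint (n : ℕ) : ENNReal.ofReal ((∫ y, g n y ∂μ) / w n) =
      ∫⁻ y, ENNReal.ofReal (g n y / w n) ∂μ := by
    have hi : Integrable (g n) μ := not_imp_comm.1 integral_undef (hpos n).ne'
    rw [← integral_div, ofReal_integral_eq_lintegral_ofReal (hi.div_const _)]
    filter_upwards [hg0] with y hy using div_nonneg (hy n) (hw n)
  have hlim' := ENNReal.tendsto_ofReal hlim
  simp only [hint, ENNReal.ofReal_zero] at hlim'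
  exact (lintegral_eq_zero_iff (Measurable.liminf hmeas)).1
    (le_antisymm ((lintegral_liminf_le hmeas).trans_eq hlim'.liminf_eq) bot_le)

/-- impossibility of analytic disaggregation: a nonnegative `C^∞`
function `f`, flat at some point `λ₀` (all derivatives, including order 0, vanish) but
not identically zero, is not a mixture, with respect to any probability measure, of
densities `g(·,y)` that are nonnegative and analytic on all of ℝ for μ-a.e. `y`. -/
theorem no_analytic_disaggregation_of_flat_density
    (f : ℝ → ℝ) (hsmooth : ContDiff ℝ (⊤ : ℕ∞) f) (hf0 : ∀ x, 0 ≤ f x)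
    (lam₀ : ℝ) (hflat : ∀ j : ℕ, iteratedDeriv j f lam₀ = 0)
    (lam₁ : ℝ) (hpos : 0 < f lam₁) :
    ∀ (Y : Type) [MeasurableSpace Y] (μ : Measure Y) [IsProbabilityMeasure μ]
      (g : ℝ → Y → ℝ),
      (∀ x : ℝ, Measurable (fun y => g x y)) →
      (∀ᵐ y ∂μ, (∀ x : ℝ, 0 ≤ g x y) ∧ AnalyticOn ℝ (fun x => g x y) Set.univ) →
      ¬ (∀ x : ℝ, f x = ∫ y, g x y ∂μ) := by
  intro Y _ μ _ g hg hae hf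
  obtain ⟨c, hc, hfreq⟩ := exists_flat_point_frequently_ne_zero hsmooth hflat hpos.ne'
  have hfc : f c = 0 := by simpa using hc 0
  obtain ⟨u, hu, hune⟩ := exists_seq_forall_of_frequently hfreq
  have hu_ne : Tendsto u atTop (𝓝[≠] c) := tendsto_nhdsWithin_iff.2
    ⟨hu, Eventually.of_forall fun n hn => hune n (by rw [hn, hfc])⟩
  have hlim (k : ℕ) : Tendsto (fun n => f (u n) / |u n - c| ^ k) atTop (𝓝 0) := by
    have h := (isLittleO_pow_of_iteratedDeriv_eq_zero hsmooth hc k).norm_right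
    simp only [norm_pow, Real.norm_eq_abs] at h
    exact h.tendsto_div_nhds_zero.comp hu
  have hliminf : ∀ᵐ y ∂μ, ∀ k : ℕ,
      liminf (fun n => ENNReal.ofReal (g (u n) y / |u n - c| ^ k)) atTop = 0 :=
    ae_all_iff.2 fun k => ae_liminf_ofReal_div_eq_zero (fun n => hg (u n))
      (hae.mono fun _ h n => h.1 (u n)) (fun _ => by positivity)
      (fun n => hf (u n) ▸ (hf0 (u n)).lt_of_ne' (hune n)) (by simpa only [hf] using hlim k)
  have hgzero : ∀ᵐ y ∂μ, g lam₁ y = 0 := by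
    filter_upwards [hae, hliminf] with y ⟨hy0, hy⟩ hylim
    rw [analyticOn_univ] at hy
    suffices h : ∀ᶠ x in 𝓝 c, g x y = 0 from
      hy.eqOn_zero_of_preconnected_of_eventuallyEq_zero isPreconnected_univ (Set.mem_univ c) h
        (Set.mem_univ lam₁)
    by_contra hne
    obtain ⟨k, L, hL, hkL⟩ := (hy c (Set.mem_univ c)).exists_tendsto_abs_div_pow hne
    simp only [abs_of_nonneg (hy0 _)] at hkL
    have h := (ENNReal.tendsto_ofReal (hkL.comp hu_ne)).liminf_eq
    simp only [Function.comp_apply] at h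
    rw [hylim k, eq_comm, ENNReal.ofReal_eq_zero] at h
    exact hL.not_ge h
  rw [hf, integral_congr_ae hgzero] at hpos
  simp at hpos
end

section
/- ('Hard' long memory example.) Let K ⊂ ℝ be a closed set with empty interior and strictly positive Lebesgue measure. Then the indicator function 1_K : ℝ → ℝ is upper semicontinuous but not lower semicontinuous. Consequently, 1_K (which, after normalization, is the density of an absolutely continuous spectral measure) cannot be written as ∫_Y g(λ,y) dμ(y) with λ ↦ g(λ,y) continuous and nonnegative for μ-a.e. y; that is, the corresponding long-memory process cannot be disaggregated into short-memory (continuous spectral density) processes. -/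
open MeasureTheory Filter Topology

/-- If almost all sections `g · y` are continuous and the mixture `∫⁻ y, g x y ∂μ` vanishes for `x`
in a dense set, then it vanishes everywhere. -/
theorem lintegral_eq_zero_of_continuous_of_dense {X Y : Type*} [TopologicalSpace X]
    [FrechetUrysohnSpace X] [MeasurableSpace Y] {μ : Measure Y} {g : X → Y → ENNReal} {s : Set X}
    (hg : ∀ x, Measurable (g x)) (hcont : ∀ᵐ y ∂μ, Continuous (fun x => g x y))
    (hs : Dense s) (hzero : ∀ x ∈ s, ∫⁻ y, g x y ∂μ = 0) (x : X) :
    ∫⁻ y, g x y ∂μ = 0 := by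
  obtain ⟨u, hus, hux⟩ := mem_closure_iff_seq_limit.mp (hs x)
  have hu : ∀ᵐ y ∂μ, ∀ n, g (u n) y = 0 :=
    ae_all_iff.mpr fun n => (lintegral_eq_zero_iff (hg _)).mp (hzero _ (hus n))
  refine (lintegral_eq_zero_iff (hg x)).mpr ?_
  filter_upwards [hcont, hu] with y hy hny
  refine tendsto_nhds_unique ((hy.tendsto x).comp hux) ?_
  simpa only [Function.comp_def, hny, Pi.zero_apply] using tendsto_const_nhds

/-- 'hard' long memory: for a closed set `K ⊂ ℝ` with empty interior and
positive Lebesgue measure, the indicator `1_K` is upper semicontinuous but not lower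
semicontinuous, and consequently it cannot be written as a mixture
`∫ g(λ,y) dμ(y)` of densities `g(·,y)` continuous (and nonnegative) for μ-a.e. `y`:
the corresponding LM process cannot be disaggregated into short-memory processes. -/
theorem hard_long_memory_indicator
    (K : Set ℝ) (hK : IsClosed K) (hKint : interior K = ∅)
    (hKpos : 0 < MeasureTheory.volume K) :
    UpperSemicontinuous (Set.indicator K (fun _ => (1 : ℝ))) ∧
    ¬ LowerSemicontinuous (Set.indicator K (fun _ => (1 : ℝ))) ∧
    ∀ (Y : Type) [MeasurableSpace Y] (μ : Measure Y) (g : ℝ → Y → ENNReal),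
      (∀ x : ℝ, Measurable (fun y => g x y)) →
      (∀ᵐ y ∂μ, Continuous (fun x : ℝ => g x y)) →
      ¬ (∀ x : ℝ, ENNReal.ofReal (Set.indicator K (fun _ => (1 : ℝ)) x)
            = ∫⁻ y, g x y ∂μ) := by
  obtain ⟨x, hx⟩ : K.Nonempty := nonempty_of_measure_ne_zero hKpos.ne'
  refine ⟨hK.upperSemicontinuous_indicator zero_le_one, fun h => ?_, ?_⟩
  · have hKx : K ∈ 𝓝 x := by
      filter_upwards [h x 0 (by simp [hx])] with z hz
      exact Set.mem_of_indicator_ne_zero hz.ne'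
    have : x ∈ interior K := mem_interior_iff_mem_nhds.mpr hKx
    simp [hKint] at this
  · intro Y _ μ g hg hcont heq
    have hint : ∫⁻ y, g x y ∂μ = 0 :=
      lintegral_eq_zero_of_continuous_of_dense hg hcont (interior_eq_empty_iff_dense_compl.mp hKint)
        (fun z hz => by rw [← heq z, Set.indicator_of_notMem hz, ENNReal.ofReal_zero]) x
    simp [← heq x, hx] at hint
end
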